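/- If G and H are finite simple graphs, each with a nonempty vertex set, then the lexicographic product G[H] satisfies γ_i(G[H]) = γ_i(G) · γ_i(H). -/

import Mathlib

/-- `S` is an independent dominating set of the simple graph `G`:
it is independent (no two vertices of `S` are adjacent) and dominating
(every vertex not in `S` has a neighbor in `S`). -/
def IsIndepDomSet {V : Type*} (G : SimpleGraph V) (S : Set V) : Prop :=
  (∀ a ∈ S, ∀ b ∈ S, ¬ G.Adj a b) ∧ (∀ v ∉ S, ∃ u ∈ S, G.Adj u v)

/-- The independent domination number `γᵢ(G)`: the minimum size of an
independent dominating set of `G`. -/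
noncomputable def indepDomNum {V : Type*} (G : SimpleGraph V) : ℕ :=
  sInf {n | ∃ S : Set V, IsIndepDomSet G S ∧ S.ncard = n}

/-- The independent domination bondage number `b_id(G)`: the minimum size of a
nonempty set `E'` of edges of `G` whose deletion changes the independent
domination number. -/
noncomputable def idBondage {V : Type*} (G : SimpleGraph V) : ℕ :=
  sInf {n | ∃ E' : Set (Sym2 V), E' ⊆ G.edgeSet ∧ E'.Nonempty ∧
    indepDomNum (G.deleteEdges E') ≠ indepDomNum G ∧ E'.ncard = n}

/-- The lexicographic product `G[H]`: vertex set `V(G) × V(H)`, with `(a, x)` adjacent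
to `(b, y)` iff `a` is adjacent to `b` in `G`, or `a = b` and `x` is adjacent to `y`
in `H`. -/
def lexProd {V W : Type*} (G : SimpleGraph V) (H : SimpleGraph W) :
    SimpleGraph (V × W) :=
  SimpleGraph.fromRel (fun x y => G.Adj x.1 y.1 ∨ (x.1 = y.1 ∧ H.Adj x.2 y.2))

theorem lexProd_adj_iff {V W : Type*} (G : SimpleGraph V) (H : SimpleGraph W) (p q : V × W) :
    (lexProd G H).Adj p q ↔ G.Adj p.1 q.1 ∨ (p.1 = q.1 ∧ H.Adj p.2 q.2) := by
  unfold lexProd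
  rw [SimpleGraph.fromRel_adj]
  constructor
  · rintro ⟨-, h | h⟩
    · exact h
    · rcases h with h | ⟨h, h'⟩
      · exact Or.inl h.symm
      · exact Or.inr ⟨h.symm, h'.symm⟩
  · intro h
    refine ⟨?_, Or.inl h⟩
    rintro rfl
    rcases h with h | ⟨-, h⟩
    · exact G.loopless.irrefl _ h
    · exact H.loopless.irrefl _ h

theorem exists_isIndepDomSet {V : Type*} [Finite V] (G : SimpleGraph V) :
    ∃ S : Set V, IsIndepDomSet G S := by
  obtain ⟨S, hS⟩ := Set.Finite.exists_maximal
    (Set.toFinite {S : Set V | ∀ a ∈ S, ∀ b ∈ S, ¬ G.Adj a b}) ⟨∅, by simp⟩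
  have hi : ∀ a ∈ S, ∀ b ∈ S, ¬ G.Adj a b := hS.1
  refine ⟨S, hi, fun v hv => ?_⟩
  by_contra hcon
  push Not at hcon
  refine hv (hS.2 (y := insert v S) ?_ (Set.subset_insert v S) (Set.mem_insert v S))
  intro a ha b hb hab
  rcases ha with rfl | ha <;> rcases hb with rfl | hb
  · exact G.loopless.irrefl _ hab
  · exact hcon b hb hab.symm
  · exact hcon a ha hab
  · exact hi a ha b hb hab

theorem exists_indepDomNum {V : Type*} [Finite V] (G : SimpleGraph V) :
    ∃ S : Set V, IsIndepDomSet G S ∧ S.ncard = indepDomNum G := by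
  obtain ⟨S, hS⟩ := exists_isIndepDomSet G
  exact Nat.sInf_mem (s := {n | ∃ S : Set V, IsIndepDomSet G S ∧ S.ncard = n}) ⟨_, S, hS, rfl⟩

theorem indepDomNum_le {V : Type*} (G : SimpleGraph V) {S : Set V} (hS : IsIndepDomSet G S) :
    indepDomNum G ≤ S.ncard :=
  Nat.sInf_le ⟨S, hS, rfl⟩

/-- If `G` and `H` are finite simple graphs with nonempty vertex sets, then
`γᵢ(G[H]) = γᵢ(G) · γᵢ(H)`. -/
theorem indepDomNum_lexProd {V W : Type*} [Fintype V] [Fintype W]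
    [Nonempty V] [Nonempty W] (G : SimpleGraph V) (H : SimpleGraph W) :
    indepDomNum (lexProd G H) = indepDomNum G * indepDomNum H := by
  classical
  apply le_antisymm
  · obtain ⟨A, hA, hAc⟩ := exists_indepDomNum G
    obtain ⟨B, hB, hBc⟩ := exists_indepDomNum H
    rw [← hAc, ← hBc, ← Set.ncard_prod]
    apply indepDomNum_le
    refine ⟨?_, ?_⟩
    · rintro ⟨a, x⟩ ⟨ha, hx⟩ ⟨b, y⟩ ⟨hb, hy⟩ h
      rw [lexProd_adj_iff] at h
      rcases h with h | ⟨-, h⟩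
      · exact hA.1 a ha b hb h
      · exact hB.1 x hx y hy h
    · rintro ⟨v, w⟩ hvw
      by_cases hv : v ∈ A
      · have hw : w ∉ B := fun hw => hvw ⟨hv, hw⟩
        obtain ⟨x, hx, hxw⟩ := hB.2 w hw
        exact ⟨(v, x), ⟨hv, hx⟩, (lexProd_adj_iff _ _ _ _).2 (Or.inr ⟨rfl, hxw⟩)⟩
      · obtain ⟨u, hu, huv⟩ := hA.2 v hv
        have hBne : B.Nonempty := by
          by_cases hw : w ∈ B
          · exact ⟨w, hw⟩
          · obtain ⟨x, hx, -⟩ := hB.2 w hw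
            exact ⟨x, hx⟩
        obtain ⟨x, hx⟩ := hBne
        exact ⟨(u, x), ⟨hu, hx⟩, (lexProd_adj_iff _ _ _ _).2 (Or.inl huv)⟩
  · obtain ⟨S, hS, hSc⟩ := exists_indepDomNum (lexProd G H)
    rw [← hSc]
    have hind : ∀ a x b y, (a, x) ∈ S → (b, y) ∈ S → ¬ G.Adj a b := fun a x b y ha hb h =>
      hS.1 _ ha _ hb ((lexProd_adj_iff _ _ _ _).2 (Or.inl h))
    have hA : IsIndepDomSet G (Prod.fst '' S) := by
      refine ⟨?_, ?_⟩
      · rintro _ ⟨⟨a, x⟩, ha, rfl⟩ _ ⟨⟨b, y⟩, hb, rfl⟩ h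
        exact hind a x b y ha hb h
      · intro v hv
        obtain ⟨w⟩ := ‹Nonempty W›
        obtain ⟨⟨u, x⟩, hu, h⟩ := hS.2 (v, w) (fun h => hv ⟨_, h, rfl⟩)
        rw [lexProd_adj_iff] at h
        rcases h with h | ⟨h, -⟩
        · exact ⟨u, ⟨_, hu, rfl⟩, h⟩
        · exact absurd ⟨_, hu, h⟩ hv
    have hF : ∀ a x, (a, x) ∈ S → IsIndepDomSet H {y | (a, y) ∈ S} := by
      intro a x hax
      refine ⟨fun y hy z hz h =>
        hS.1 _ hy _ hz ((lexProd_adj_iff _ _ _ _).2 (Or.inr ⟨rfl, h⟩)), fun y hy => ?_⟩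
      obtain ⟨⟨u, z⟩, hu, h⟩ := hS.2 (a, y) hy
      rw [lexProd_adj_iff] at h
      rcases h with h | ⟨h, h'⟩
      · exact absurd h (hind u z a x hu hax)
      · obtain rfl : u = a := h
        exact ⟨z, hu, h'⟩
    have hle := indepDomNum_le G hA
    refine (Nat.mul_le_mul_right _ hle).trans ?_
    rw [← Set.coe_toFinset S, ← Finset.coe_image, Set.ncard_coe_finset, Set.ncard_coe_finset,
      mul_comm]
    refine Finset.mul_card_image_le_card _ _ ?_
    intro a ha
    obtain ⟨⟨a', x⟩, hax, rfl⟩ := Finset.mem_image.1 ha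
    rw [Set.mem_toFinset] at hax
    refine (indepDomNum_le H (hF a' x hax)).trans ?_
    rw [← Set.ncard_image_of_injective _ (Prod.mk_right_injective a'), ← Set.ncard_coe_finset]
    apply Set.ncard_le_ncard _ (Finset.finite_toSet _)
    rintro _ ⟨y, hy, rfl⟩
    simpa using hy
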